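/- arXiv:2508.12041 — 2 statements merged into one kernel-verified Lean document; each statement's English description precedes it below -/
import Mathlib

section
/- In the algebra Uı, for every integer l ≥ 0 and every integer d, the following identity holds: B₁ · (B₂ B₁^{(l+1+d)} B₂^{(l)}) = [l+1+d] · B₂ B₁^{(l+2+d)} B₂^{(l)} + [l+1] · B₁^{(l+2+d)} B₂^{(l+1)} − [l+1+d] · B₁^{(l+1+d)} B₂^{(l)} · {k₁; l − 3/2 − 2d}, where divided powers with negative superscript are zero. -/
noncomputable section

namespace UiAIII

/-- The base field `K = ℚ(t)`, where `q := t²`. -/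
abbrev K : Type := RatFunc ℚ

/-- `t^s` for `s : ℤ`; so `tz (2*n)` represents `q^n` and `tz s` represents `q^{s/2}`. -/
def tz (s : ℤ) : K := (RatFunc.X : K) ^ s

/-- The quantum integer `[n] = (q^n - q^{-n})/(q - q^{-1})`, with `q = t²`. -/
def qint (n : ℤ) : K := (tz (2 * n) - tz (-(2 * n))) / (tz 2 - tz (-2))

/-- The quantum factorial `[n]!`. -/
def qfact (n : ℕ) : K := ∏ i ∈ Finset.range n, qint ((i : ℤ) + 1)

variable {A : Type*} [Ring A] [Algebra K A]

/-- Divided power `x^{(m)} = x^m/[m]!` for `m ≥ 0`, and `0` for `m < 0`. -/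
def dp (x : A) (m : ℤ) : A := if 0 ≤ m then (qfact m.toNat)⁻¹ • x ^ m.toNat else 0

/-- `{k; s/2} := q^{s/2}·k + q^{-s/2}·k⁻¹`; the argument `s` is twice the half-integer. -/
def brace (k kinv : A) (s : ℤ) : A := tz s • k + tz (-s) • kinv

/-- `k^j` for `j : ℤ`, using the two-sided inverse `kinv` of `k`. -/
def upow (k kinv : A) (j : ℤ) : A := if 0 ≤ j then k ^ j.toNat else kinv ^ (-j).toNat

end UiAIII

open UiAIII

namespace UiAIII

lemma tz_add (a b : ℤ) : tz (a + b) = tz a * tz b :=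
  zpow_add₀ RatFunc.X_ne_zero a b

lemma tz_zero : tz 0 = 1 := zpow_zero _

lemma tz_mul_tz_neg (a : ℤ) : tz a * tz (-a) = 1 := by
  rw [← tz_add, add_neg_cancel, tz_zero]

lemma tz_natCast_ne_one {m : ℕ} (hm : m ≠ 0) : tz m ≠ 1 := by
  intro h
  rw [tz, zpow_natCast, ← RatFunc.algebraMap_X, ← map_pow,
    ← map_one (algebraMap (Polynomial ℚ) (RatFunc ℚ))] at h
  have h' := congrArg Polynomial.natDegree (RatFunc.algebraMap_injective ℚ h)
  simp [hm] at h'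

lemma tz_sub_tz_neg_ne_zero {m : ℕ} (hm : m ≠ 0) : tz m - tz (-m) ≠ 0 := by
  intro h
  apply tz_natCast_ne_one (m := m + m) (by omega)
  rw [Nat.cast_add, tz_add]
  nth_rewrite 2 [sub_eq_zero.mp h]
  exact tz_mul_tz_neg _

lemma tz_two_sub_ne_zero : tz 2 - tz (-2) ≠ 0 :=
  tz_sub_tz_neg_ne_zero (m := 2) two_ne_zero

lemma qint_succ_ne_zero (n : ℕ) : qint ((n : ℤ) + 1) ≠ 0 := by
  refine div_ne_zero ?_ tz_two_sub_ne_zero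
  exact_mod_cast tz_sub_tz_neg_ne_zero (m := 2 * (n + 1)) (by omega)

lemma qint_zero : qint 0 = 0 := by simp [qint]

lemma qint_one : qint 1 = 1 := div_self tz_two_sub_ne_zero

lemma qint_neg (n : ℤ) : qint (-n) = -qint n := by
  simp only [qint, mul_neg, neg_neg, ← neg_div, neg_sub]

lemma qint_two : qint 2 = tz 2 + tz (-2) := by
  rw [qint, div_eq_iff tz_two_sub_ne_zero, show (2 * 2 : ℤ) = 2 + 2 by norm_num,
    show (-(2 + 2) : ℤ) = -2 + -2 by norm_num, tz_add, tz_add]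
  ring

lemma qint_add_two (n : ℤ) : qint (n + 2) = qint 2 * qint (n + 1) - qint n := by
  rw [qint_two, qint, qint, qint, mul_div_assoc', ← sub_div]
  congr 1
  rw [show 2 * (n + 2) = 2 * n + 2 + 2 by ring, show 2 * (n + 1) = 2 * n + 2 by ring,
    show -(2 * n + 2 + 2) = -(2 * n) + -2 + -2 by ring,
    show -(2 * n + 2) = -(2 * n) + -2 by ring]
  simp only [tz_add]
  linear_combination (tz (-(2 * n)) - tz (2 * n)) * tz_mul_tz_neg 2

/-- `[n] q^{s/2} + [2] q^{s/2 - n - 2} = [n + 2] q^{s/2 - 2}`. -/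
lemma qint_mul_tz_add (n s : ℤ) :
    qint n * tz s + qint 2 * tz (s - 4 - 2 * n) = qint (n + 2) * tz (s - 4) := by
  rw [qint_two, qint, qint, div_mul_eq_mul_div, div_mul_eq_mul_div,
    div_add' _ _ _ tz_two_sub_ne_zero]
  congr 1
  rw [show 2 * (n + 2) = 2 * n + 2 + 2 by ring,
    show -(2 * n + 2 + 2) = -(2 * n) + -2 + -2 by ring,
    show s - 4 - 2 * n = s + -2 + -2 + -(2 * n) by ring,
    show s - 4 = s + -2 + -2 by ring]
  simp only [tz_add]
  linear_combination tz s * (tz (-(2 * n)) - tz (2 * n)) *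
    (tz 2 * tz (-2) + 1) * tz_mul_tz_neg 2

lemma qint_neg_mul_tz_add (n s : ℤ) :
    qint n * tz (-s) + qint 2 * tz (-(s - 4 - 2 * n)) = qint (n + 2) * tz (-(s - 4)) := by
  rw [qint_two, qint, qint, div_mul_eq_mul_div, div_mul_eq_mul_div,
    div_add' _ _ _ tz_two_sub_ne_zero]
  congr 1
  rw [show 2 * (n + 2) = 2 * n + 2 + 2 by ring,
    show -(2 * n + 2 + 2) = -(2 * n) + -2 + -2 by ring,
    show -(s - 4 - 2 * n) = -s + 2 + 2 + 2 * n by ring,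
    show -(s - 4) = -s + 2 + 2 by ring]
  simp only [tz_add]
  linear_combination tz (-s) * (tz (-(2 * n)) - tz (2 * n)) *
    (tz 2 * tz (-2) + 1) * tz_mul_tz_neg 2

lemma qfact_succ (n : ℕ) : qfact (n + 1) = qfact n * qint ((n : ℤ) + 1) :=
  Finset.prod_range_succ _ _

variable {A : Type*} [Ring A] [Algebra K A]

lemma dp_of_neg (x : A) {m : ℤ} (hm : m < 0) : dp x m = 0 := if_neg hm.not_ge

lemma dp_natCast (x : A) (n : ℕ) : dp x n = (qfact n)⁻¹ • x ^ n := by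
  simp [dp]

lemma qint_smul_dp_succ (x : A) (n : ℕ) :
    qint ((n : ℤ) + 1) • dp x ((n : ℤ) + 1) = (qfact n)⁻¹ • x ^ (n + 1) := by
  have h := qint_succ_ne_zero n
  rw [← Nat.cast_succ, dp_natCast, qfact_succ, smul_smul, mul_inv, Nat.cast_succ,
    mul_left_comm, mul_inv_cancel₀ h, mul_one]

lemma mul_dp (x : A) (n : ℕ) : x * dp x n = qint ((n : ℤ) + 1) • dp x ((n : ℤ) + 1) := by
  rw [qint_smul_dp_succ, dp_natCast, mul_smul_comm, pow_succ']

lemma brace_mul {k k' x : A} {c : ℤ} (hk : k * k' = 1) (hk' : k' * k = 1)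
    (hx : k * x = tz c • (x * k)) (s : ℤ) :
    brace k k' s * x = x * brace k k' (s + c) := by
  have hx' : k' * x = tz (-c) • (x * k') := by
    have h := congrArg (fun y => tz (-c) • (k' * y * k')) hx
    simp only [mul_smul_comm, smul_mul_assoc, smul_smul] at h
    rw [mul_comm, tz_mul_tz_neg, one_smul, ← mul_assoc, hk', one_mul, mul_assoc k',
      mul_assoc x, hk, mul_one] at h
    exact h.symm
  rw [brace, brace, add_mul, smul_mul_assoc, smul_mul_assoc, hx, hx', smul_smul, smul_smul,
    ← tz_add, ← tz_add, mul_add, mul_smul_comm, mul_smul_comm, neg_add]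

lemma brace_mul_pow {k k' x : A} {c : ℤ} (hk : k * k' = 1) (hk' : k' * k = 1)
    (hx : k * x = tz c • (x * k)) (s : ℤ) (n : ℕ) :
    brace k k' s * x ^ n = x ^ n * brace k k' (s + c * n) := by
  induction n with
  | zero => simp
  | succ n ih =>
    rw [pow_succ, ← mul_assoc, ih, mul_assoc, brace_mul hk hk' hx, ← mul_assoc]
    congr 2
    push_cast
    ring

lemma qint_smul_brace_add (k k' : A) (n s : ℤ) :
    qint n • brace k k' s + qint 2 • brace k k' (s - 4 - 2 * n)
      = qint (n + 2) • brace k k' (s - 4) := by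
  have h₁ := qint_mul_tz_add n s
  have h₂ := qint_neg_mul_tz_add n s
  simp only [brace, smul_add, smul_smul, ← h₁, ← h₂, add_smul]
  abel

/-- `module` needs this structure rather than `RatFunc.instAlgebraOfPolynomial`. -/
local instance : Algebra ℕ K := Semiring.toNatAlgebra

/-- `module` needs this structure rather than `RatFunc.instAlgebraOfPolynomial`. -/
local instance : Algebra ℤ K := Ring.toIntAlgebra K

/-- Commuting `B₁` past `B₂` in front of a power of `B₁`. -/
lemma mul_mul_pow {B1 B2 k1 k1' : A} (hk : k1 * k1' = 1) (hk' : k1' * k1 = 1)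
    (hkB1 : k1 * B1 = tz (-6) • (B1 * k1))
    (hS1 : B1 ^ 2 * B2 - qint 2 • (B1 * B2 * B1) + B2 * B1 ^ 2
      = qint 2 • (B1 * brace k1 k1' (-3))) (n : ℕ) :
    qint ((n : ℤ) + 1) • (B1 * (B2 * B1 ^ n))
      = qint n • (B2 * B1 ^ (n + 1)) + B1 ^ (n + 1) * B2
        - (qint n * qint ((n : ℤ) + 1)) • (B1 ^ n * brace k1 k1' (1 - 4 * n)) := by
  induction n with
  | zero => simp [qint_zero, qint_one]
  | succ n ih =>
    have hl := congrArg (fun y => B1 * y) ih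
    have hr := congrArg (fun y => y * B1 ^ n) hS1
    simp only [mul_add, mul_sub, mul_smul_comm, ← mul_assoc, ← pow_succ', ← sq] at hl
    simp only [add_mul, sub_mul, smul_mul_assoc, mul_assoc, brace_mul_pow hk hk' hkB1,
      ← pow_succ', ← pow_add] at hr
    simp only [← mul_assoc, ← pow_succ'] at hr
    have hb := congrArg (fun y => B1 ^ (n + 1) * y)
      (qint_smul_brace_add k1 k1' (n : ℤ) (1 - 4 * n))
    simp only [mul_add, mul_smul_comm] at hb
    rw [show (1 : ℤ) - 4 * n - 4 - 2 * n = -3 + -6 * n by ring] at hb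
    rw [add_comm 2 n] at hr
    push_cast
    rw [show (n : ℤ) + 1 + 1 = n + 2 by ring,
      show (1 : ℤ) - 4 * (n + 1) = 1 - 4 * n - 4 by ring]
    rw [← mul_assoc B1 B2]
    have hq := qint_add_two (n : ℤ)
    rw [mul_smul, ← hb, hq]
    linear_combination (norm := module) hl - qint ((n : ℤ) + 1) • hr

/-- The divided power form of `mul_mul_pow`. -/
lemma mul_mul_dp {B1 B2 k1 k1' : A} (hk : k1 * k1' = 1) (hk' : k1' * k1 = 1)
    (hkB1 : k1 * B1 = tz (-6) • (B1 * k1))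
    (hS1 : B1 ^ 2 * B2 - qint 2 • (B1 * B2 * B1) + B2 * B1 ^ 2
      = qint 2 • (B1 * brace k1 k1' (-3))) (n : ℕ) :
    B1 * (B2 * dp B1 n) = qint n • (B2 * dp B1 ((n : ℤ) + 1))
      + dp B1 ((n : ℤ) + 1) * B2 - qint n • (dp B1 n * brace k1 k1' (1 - 4 * n)) := by
  have h := mul_mul_pow hk hk' hkB1 hS1 n
  have hdp := qint_smul_dp_succ B1 n
  apply smul_right_injective A (qint_succ_ne_zero n)
  simp only [smul_add, smul_sub, smul_comm (qint ((n : ℤ) + 1)) (qint n)]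
  rw [← mul_smul_comm _ B2 (dp B1 _), ← smul_mul_assoc _ (dp B1 _) B2, hdp]
  simp only [dp_natCast, mul_smul_comm, smul_mul_assoc]
  linear_combination (norm := module) (qfact n)⁻¹ • h

end UiAIII

/-- Lemma 4.3 (eq. 4.4) of the paper: for `l ≥ 0` and `d ∈ ℤ`,
`B₁·(B₂ B₁^{(l+1+d)} B₂^{(l)}) = [l+1+d]·B₂B₁^{(l+2+d)}B₂^{(l)} + [l+1]·B₁^{(l+2+d)}B₂^{(l+1)}
   − [l+1+d]·B₁^{(l+1+d)}B₂^{(l)}·{k₁; l−3/2−2d}`, in any algebra with elements satisfying the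
defining relations of the quasi-split iquantum group Uı of type AIII for sl₃ with
parameters ς₁ = ς₂ = −q^{1/2}. -/
theorem statement0 (A : Type*) [Ring A] [Algebra K A]
    (B1 B2 k1 k1' : A)
    (hk : k1 * k1' = 1) (hk' : k1' * k1 = 1)
    (hkB1 : k1 * B1 = tz (-6) • (B1 * k1))
    (hkB2 : k1 * B2 = tz 6 • (B2 * k1))
    (hS1 : B1 ^ 2 * B2 - qint 2 • (B1 * B2 * B1) + B2 * B1 ^ 2
        = qint 2 • (B1 * (tz (-3) • k1 + tz 3 • k1')))
    (hS2 : B2 ^ 2 * B1 - qint 2 • (B2 * B1 * B2) + B1 * B2 ^ 2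
        = qint 2 • (B2 * (tz 3 • k1 + tz (-3) • k1')))
    (l : ℕ) (d : ℤ) :
    B1 * (B2 * dp B1 ((l : ℤ) + 1 + d) * dp B2 (l : ℤ))
      = qint ((l : ℤ) + 1 + d) • (B2 * dp B1 ((l : ℤ) + 2 + d) * dp B2 (l : ℤ))
        + qint ((l : ℤ) + 1) • (dp B1 ((l : ℤ) + 2 + d) * dp B2 ((l : ℤ) + 1))
        - qint ((l : ℤ) + 1 + d) •
            (dp B1 ((l : ℤ) + 1 + d) * dp B2 (l : ℤ) *
              brace k1 k1' (2 * (l : ℤ) - 3 - 4 * d)) := by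
  obtain ⟨n, rfl⟩ : ∃ n : ℤ, d = n - 1 - l := ⟨l + 1 + d, by ring⟩
  rw [show (l : ℤ) + 1 + (n - 1 - l) = n by ring, show (l : ℤ) + 2 + (n - 1 - l) = n + 1 by ring,
    show 2 * (l : ℤ) - 3 - 4 * (n - 1 - l) = 1 - 4 * n + 6 * l by ring]
  rcases lt_or_ge n 0 with hn | hn
  · rcases eq_or_ne n (-1) with rfl | hn'
    · have h0 : dp B1 (-1 + 1) = 1 := by simp [dp, qfact]
      rw [h0, dp_of_neg B1 hn, qint_neg, qint_one, one_mul, mul_one, mul_dp]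
      simp
    · simp [dp_of_neg B1 hn, dp_of_neg B1 (show n + 1 < 0 by omega)]
  · lift n to ℕ using hn
    have hS : B1 ^ 2 * B2 - qint 2 • (B1 * B2 * B1) + B2 * B1 ^ 2
        = qint 2 • (B1 * brace k1 k1' (-3)) := by
      simpa [brace] using hS1
    have hB : brace k1 k1' (1 - 4 * n) * dp B2 l
        = dp B2 l * brace k1 k1' (1 - 4 * n + 6 * l) := by
      rw [dp_natCast, mul_smul_comm, smul_mul_assoc, brace_mul_pow hk hk' hkB2]
    rw [← mul_assoc, mul_mul_dp hk hk' hkB1 hS n, sub_mul, add_mul, smul_mul_assoc, smul_mul_assoc,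
      mul_assoc _ B2 (dp B2 l), mul_dp B2, mul_assoc _ (brace _ _ _), hB, mul_smul_comm,
      ← mul_assoc (dp B1 n)]
end
end

section
/- In the algebra Uı, for all integers t ≥ 0 and l ≥ 0, the following identity holds: B₂^{(t)} B₁^{(l+t)} B₂^{(l)} = B₁^{(l)} B₂^{(l+t)} B₁^{(t)}. -/
noncomputable section

open UiAIII

/-- If `x` can be moved across each generator at the cost of an element of the generated
subalgebra, then it can be moved across the whole subalgebra. -/
theorem exists_mul_eq_mul_of_mem_adjoin {F A : Type*} [Field F] [Ring A] [Algebra F A]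
    {s : Set A} {x : A}
    (h : ∀ c ∈ s, ∃ d ∈ Algebra.adjoin F s, x * c = d * x) {c : A}
    (hc : c ∈ Algebra.adjoin F s) : ∃ d ∈ Algebra.adjoin F s, x * c = d * x := by
  induction hc using Algebra.adjoin_induction with
  | mem c hc => exact h c hc
  | algebraMap r => exact ⟨_, Subalgebra.algebraMap_mem _ r, (Algebra.commutes r x).symm⟩
  | add c c' _ _ h₁ h₂ =>
    obtain ⟨d, hd, e⟩ := h₁
    obtain ⟨d', hd', e'⟩ := h₂
    exact ⟨d + d', add_mem hd hd', by rw [mul_add, e, e', add_mul]⟩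
  | mul c c' _ _ h₁ h₂ =>
    obtain ⟨d, hd, e⟩ := h₁
    obtain ⟨d', hd', e'⟩ := h₂
    exact ⟨d * d', mul_mem hd hd', by rw [← mul_assoc, e, mul_assoc, e', mul_assoc]⟩

theorem pow_mul_pow_mem_adjoin {F A : Type*} [Field F] [Ring A] [Algebra F A]
    {s : Set A} {x y : A} (hxy : x * y ∈ s)
    (h : ∀ c ∈ s, ∃ d ∈ Algebra.adjoin F s, x * c = d * x) (n : ℕ) :
    x ^ n * y ^ n ∈ Algebra.adjoin F s := by
  induction n with
  | zero => simp
  | succ n ih =>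
    obtain ⟨d, hd, e⟩ := exists_mul_eq_mul_of_mem_adjoin h ih
    have : x ^ (n + 1) * y ^ (n + 1) = d * (x * y) := by
      rw [pow_succ', pow_succ, ← mul_assoc d, ← e]
      simp only [mul_assoc]
    rw [this]
    exact mul_mem hd (Algebra.subset_adjoin hxy)

/-- An element `x` which `q`-commutes with `k` and satisfies a deformed Serre relation with `y`
moves across the generators `k`, `k⁻¹`, `xy`, `yx`. -/
theorem exists_mul_eq_mul_of_serre {F A : Type*} [Field F] [Ring A] [Algebra F A]
    {s : Set A} {x y k k' : A} {a p u v : F} (ha : a ≠ 0)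
    (hk : k * k' = 1) (hk' : k' * k = 1) (hkx : k * x = a • (x * k))
    (hS : x ^ 2 * y - p • (x * y * x) + y * x ^ 2 = p • (x * (u • k + v • k')))
    (hs : s = {k, k', x * y, y * x}) :
    ∀ c ∈ s, ∃ d ∈ Algebra.adjoin F s, x * c = d * x := by
  have mk : k ∈ Algebra.adjoin F s := Algebra.subset_adjoin (by simp [hs])
  have mk' : k' ∈ Algebra.adjoin F s := Algebra.subset_adjoin (by simp [hs])
  have mxy : x * y ∈ Algebra.adjoin F s := Algebra.subset_adjoin (by simp [hs])
  have myx : y * x ∈ Algebra.adjoin F s := Algebra.subset_adjoin (by simp [hs])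
  have hxk : x * k = a⁻¹ • k * x := by
    rw [smul_mul_assoc, hkx, inv_smul_smul₀ ha]
  have hxk' : x * k' = a • k' * x := by
    calc x * k' = k' * (k * x) * k' := by rw [← mul_assoc k', hk', one_mul]
      _ = a • k' * x := by
        rw [hkx, mul_smul_comm, smul_mul_assoc, smul_mul_assoc, ← mul_assoc, mul_assoc _ k, hk,
          mul_one]
  intro c hc
  rw [hs] at hc
  rcases hc with rfl | rfl | rfl | rfl
  · exact ⟨_, Subalgebra.smul_mem _ mk _, hxk⟩
  · exact ⟨_, Subalgebra.smul_mem _ mk' _, hxk'⟩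
  · refine ⟨p • (x * y) - y * x + p • (u • a⁻¹ • k + v • a • k'), ?_, ?_⟩
    · exact add_mem (sub_mem (Subalgebra.smul_mem _ mxy _) myx) (Subalgebra.smul_mem _
        (add_mem (Subalgebra.smul_mem _ (Subalgebra.smul_mem _ mk _) _)
          (Subalgebra.smul_mem _ (Subalgebra.smul_mem _ mk' _) _)) _)
    · have e : x * (u • k + v • k') = (u • a⁻¹ • k + v • a • k') * x := by
        rw [mul_add, mul_smul_comm, mul_smul_comm, hxk, hxk', add_mul, smul_mul_assoc u,
          smul_mul_assoc v]
      rw [e] at hS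
      rw [add_mul, sub_mul, smul_mul_assoc p (_ + _), ← hS, smul_mul_assoc]
      noncomm_ring
  · exact ⟨_, mxy, (mul_assoc _ _ _).symm⟩

/-- Corollary 4.5 of the paper: `B₂^{(t)} B₁^{(l+t)} B₂^{(l)} = B₁^{(l)} B₂^{(l+t)} B₁^{(t)}`
for all `t, l ≥ 0`, in any algebra with elements satisfying the defining relations of the
quasi-split iquantum group Uı of type AIII for sl₃ with parameters ς₁ = ς₂ = −q^{1/2}. -/
theorem statement2 (A : Type*) [Ring A] [Algebra K A]
    (B1 B2 k1 k1' : A)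
    (hk : k1 * k1' = 1) (hk' : k1' * k1 = 1)
    (hkB1 : k1 * B1 = tz (-6) • (B1 * k1))
    (hkB2 : k1 * B2 = tz 6 • (B2 * k1))
    (hS1 : B1 ^ 2 * B2 - qint 2 • (B1 * B2 * B1) + B2 * B1 ^ 2
        = qint 2 • (B1 * (tz (-3) • k1 + tz 3 • k1')))
    (hS2 : B2 ^ 2 * B1 - qint 2 • (B2 * B1 * B2) + B1 * B2 ^ 2
        = qint 2 • (B2 * (tz 3 • k1 + tz (-3) • k1')))
    (t l : ℕ) :
    dp B2 (t : ℤ) * dp B1 ((l : ℤ) + t) * dp B2 (l : ℤ)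
      = dp B1 (l : ℤ) * dp B2 ((l : ℤ) + t) * dp B1 (t : ℤ) := by
  have t0 (n : ℤ) : tz n ≠ 0 := zpow_ne_zero _ RatFunc.X_ne_zero
  have tadd (m n : ℤ) : tz m * tz n = tz (m + n) := (zpow_add₀ RatFunc.X_ne_zero _ _).symm
  have hkB2' : k1' * B2 = tz (-6) • (B2 * k1') := by
    have e : k1' * (k1 * B2) * k1' = tz 6 • (k1' * B2) := by
      rw [hkB2, mul_smul_comm, smul_mul_assoc, ← mul_assoc, mul_assoc _ k1, hk, mul_one]
    rw [← mul_assoc, hk', one_mul] at e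
    rw [e, smul_smul, tadd]
    simp [tz]
  have hkB1' : k1' * B1 = tz 6 • (B1 * k1') := by
    have e : k1' * (k1 * B1) * k1' = tz (-6) • (k1' * B1) := by
      rw [hkB1, mul_smul_comm, smul_mul_assoc, ← mul_assoc, mul_assoc _ k1, hk, mul_one]
    rw [← mul_assoc, hk', one_mul] at e
    rw [e, smul_smul, tadd]
    simp [tz]
  have ck {k x y : A} {m : ℤ} (hx : k * x = tz m • (x * k)) (hy : k * y = tz (-m) • (y * k)) :
      Commute k (x * y) := by
    rw [Commute, SemiconjBy, ← mul_assoc, hx, smul_mul_assoc, mul_assoc, hy, mul_smul_comm,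
      smul_smul, tadd, mul_assoc]
    simp [tz]
  have h12 : Commute (B1 * B2) (B2 * B1) := by
    have e : (tz (-3) • k1 + tz 3 • k1') * B2 = B2 * (tz 3 • k1 + tz (-3) • k1') := by
      rw [add_mul, smul_mul_assoc, smul_mul_assoc, hkB2, hkB2', smul_smul, smul_smul, tadd, tadd,
        mul_add, mul_smul_comm, mul_smul_comm]
      norm_num
    have e1 := congrArg (· * B2) hS1
    have e2 := congrArg (B1 * ·) hS2
    simp only [smul_mul_assoc, mul_smul_comm, mul_assoc, e] at e1 e2
    have e3 := e1.trans e2.symm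
    simp only [add_mul, sub_mul, mul_add, mul_sub, smul_mul_assoc, mul_smul_comm, pow_two,
      mul_assoc] at e3
    rw [Commute, SemiconjBy]
    simp only [mul_assoc]
    rw [sub_add_eq_add_sub, sub_add_eq_add_sub, sub_left_inj, add_comm, add_left_inj] at e3
    exact e3.symm
  set s : Set A := {k1, k1', B1 * B2, B2 * B1} with hs
  have hs' : s = {k1, k1', B2 * B1, B1 * B2} := by rw [hs, Set.pair_comm (B1 * B2)]
  have hcomm : ∀ a ∈ s, ∀ b ∈ s, Commute a b := by
    have c1 : Commute k1 k1' := hk.trans hk'.symm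
    have c2 : Commute k1 (B1 * B2) := ck hkB1 hkB2
    have c3 : Commute k1 (B2 * B1) := ck hkB2 hkB1
    have c4 : Commute k1' (B1 * B2) := ck hkB1' hkB2'
    have c5 : Commute k1' (B2 * B1) := ck hkB2' hkB1'
    rintro a (rfl | rfl | rfl | rfl) b (rfl | rfl | rfl | rfl) <;>
      first | exact Commute.refl _ | assumption | (apply Commute.symm; assumption)
  have m1 : B1 ^ l * B2 ^ l ∈ Algebra.adjoin K s := pow_mul_pow_mem_adjoin (by simp [hs])
    (exists_mul_eq_mul_of_serre (t0 _) hk hk' hkB1 hS1 hs) l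
  have m2 : B2 ^ t * B1 ^ t ∈ Algebra.adjoin K s := pow_mul_pow_mem_adjoin (by simp [hs])
    (exists_mul_eq_mul_of_serre (t0 _) hk hk' hkB2 hS2 hs') t
  have key : Commute (B2 ^ t * B1 ^ t) (B1 ^ l * B2 ^ l) :=
    Set.centralizer_centralizer_comm_of_comm hcomm
      _ (Algebra.adjoin_le_centralizer_centralizer K s m2)
      _ (Algebra.adjoin_le_centralizer_centralizer K s m1)
  have key' : B2 ^ t * B1 ^ (l + t) * B2 ^ l = B1 ^ l * B2 ^ (l + t) * B1 ^ t := by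
    have := key.eq
    rw [add_comm l t, pow_add B1, add_comm t l, pow_add B2]
    simpa only [mul_assoc] using this
  have dpn (x : A) (n : ℕ) : dp x (n : ℤ) = (qfact n)⁻¹ • x ^ n := by simp [dp]
  rw [← Nat.cast_add, dpn, dpn, dpn, dpn, dpn, dpn]
  simp only [smul_mul_assoc, mul_smul_comm, smul_smul, key']
  congr 1
  ring
end
end
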